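/- Let ℓ ≥ 2 and m ≥ 1 be integers. The module D(cCat_ℓ(m)) is a free ℂ[x_1,…,x_ℓ,z]-module of rank ℓ + 1 admitting a basis of homogeneous elements of degrees 0, 1, mℓ+1, mℓ+2, …, mℓ+ℓ−1. -/

import Mathlib

open MvPolynomial Polynomial

noncomputable section

/-- R = ℂ[x_1, …, x_ℓ, z]; the variable indexed by `Fin.last ℓ` is z. -/
abbrev R (ℓ : ℕ) := MvPolynomial (Fin (ℓ + 1)) ℂ

/-- D(cCat_ℓ(m)). -/
def DcCat (ℓ m : ℕ) : Submodule (R ℓ) (Fin (ℓ + 1) → R ℓ) where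
  carrier := {f | MvPolynomial.X (Fin.last ℓ) ∣ f (Fin.last ℓ) ∧
    ∀ i j : Fin ℓ, i < j → ∀ p : ℤ, -(m : ℤ) ≤ p → p ≤ m →
      (MvPolynomial.X i.castSucc - MvPolynomial.X j.castSucc -
          (p : R ℓ) * MvPolynomial.X (Fin.last ℓ)) ∣
        (f i.castSucc - f j.castSucc - (p : R ℓ) * f (Fin.last ℓ))}
  zero_mem' := by
    refine ⟨by simp, ?_⟩
    intro i j _ p _ _
    simp
  add_mem' := by
    intro f g hf hg
    refine ⟨?_, ?_⟩
    · have := hf.1.add hg.1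
      simpa using this
    · intro i j hij p hp1 hp2
      have h := (hf.2 i j hij p hp1 hp2).add (hg.2 i j hij p hp1 hp2)
      have e : (f i.castSucc - f j.castSucc - (p : R ℓ) * f (Fin.last ℓ)) +
          (g i.castSucc - g j.castSucc - (p : R ℓ) * g (Fin.last ℓ)) =
          (f + g) i.castSucc - (f + g) j.castSucc - (p : R ℓ) * (f + g) (Fin.last ℓ) := by
        simp only [Pi.add_apply]; ring
      rwa [e] at h
  smul_mem' := by
    intro c f hf
    refine ⟨?_, ?_⟩
    · have := hf.1.mul_left c
      simpa using this
    · intro i j hij p hp1 hp2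
      have h := (hf.2 i j hij p hp1 hp2).mul_left c
      have e : c * (f i.castSucc - f j.castSucc - (p : R ℓ) * f (Fin.last ℓ)) =
          (c • f) i.castSucc - (c • f) j.castSucc - (p : R ℓ) * (c • f) (Fin.last ℓ) := by
        simp only [Pi.smul_apply, smul_eq_mul]; ring
      rwa [e] at h

/-! ### Saito's criterion for central hyperplane arrangements -/

section Saito

variable {σ K : Type*} [Fintype σ] [Field K]

/-- The value `∑ i, c i * f i` of the linear form with coefficients `c` at the vector `f`. -/
def formAt (c : σ → K) (f : σ → MvPolynomial σ K) : MvPolynomial σ K :=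
  ∑ i, MvPolynomial.C (c i) * f i

/-- The linear form with coefficients `c`. -/
def linForm (c : σ → K) : MvPolynomial σ K :=
  formAt c MvPolynomial.X

lemma isHomogeneous_linForm (c : σ → K) : (linForm c).IsHomogeneous 1 :=
  IsHomogeneous.sum _ _ _ fun i _ => isHomogeneous_C_mul_X (c i) i

lemma coeff_linForm [DecidableEq σ] (c : σ → K) (i : σ) :
    MvPolynomial.coeff (Finsupp.single i 1) (linForm c) = c i := by
  simp [linForm, formAt, MvPolynomial.coeff_sum, MvPolynomial.coeff_C_mul,
    MvPolynomial.coeff_X, Finsupp.single_left_inj]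

lemma linForm_ne_zero {c : σ → K} (hc : c ≠ 0) : linForm c ≠ 0 := by
  classical
  intro h
  refine hc (funext fun i => ?_)
  rw [← coeff_linForm c i, h]
  simp

lemma irreducible_linForm {c : σ → K} (hc : c ≠ 0) : Irreducible (linForm c) := by
  refine irreducible_of_totalDegree_eq_one
    ((isHomogeneous_linForm c).totalDegree (linForm_ne_zero hc)) fun x hx => ?_
  rw [isUnit_iff_ne_zero]
  rintro rfl
  exact linForm_ne_zero hc (MvPolynomial.ext _ _ fun s => by simpa using hx s)

lemma isRelPrime_linForm {c c' : σ → K} (hc : c ≠ 0) (hc' : c' ≠ 0)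
    (h : ∀ a : K, c' ≠ a • c) : IsRelPrime (linForm c) (linForm c') := by
  classical
  rw [(irreducible_linForm hc).isRelPrime_iff_not_dvd]
  rintro ⟨q, hq⟩
  have hq0 : q ≠ 0 := by
    rintro rfl
    exact linForm_ne_zero hc' (by simpa using hq)
  have hdeg := congrArg MvPolynomial.totalDegree hq
  rw [totalDegree_mul_of_isDomain (linForm_ne_zero hc) hq0,
    (isHomogeneous_linForm c).totalDegree (linForm_ne_zero hc),
    (isHomogeneous_linForm c').totalDegree (linForm_ne_zero hc')] at hdeg
  have hqC := totalDegree_eq_zero_iff_eq_C.mp (show q.totalDegree = 0 by omega)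
  refine h (MvPolynomial.coeff 0 q) (funext fun i => ?_)
  have hi := congrArg (MvPolynomial.coeff (Finsupp.single i 1)) hq
  rw [hqC, mul_comm, MvPolynomial.coeff_C_mul, coeff_linForm, coeff_linForm] at hi
  simpa using hi

variable [DecidableEq σ]

lemma linForm_dvd_det {c : σ → K} (hc : c ≠ 0) {M : Matrix σ σ (MvPolynomial σ K)}
    (hM : ∀ a, linForm c ∣ formAt c (M a)) : linForm c ∣ M.det := by
  obtain ⟨i, hi⟩ := Function.ne_iff.mp hc
  have hadj : M.adjugate.mulVec (M.mulVec fun i => MvPolynomial.C (c i)) i =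
      M.det * MvPolynomial.C (c i) := by
    rw [Matrix.mulVec_mulVec, Matrix.adjugate_mul, Matrix.smul_mulVec, Matrix.one_mulVec]
    simp
  have hdvd : linForm c ∣ M.det * MvPolynomial.C (c i) := by
    rw [← hadj]
    refine Finset.dvd_sum fun a _ => Dvd.dvd.mul_left ?_ _
    convert hM a using 1
    exact Finset.sum_congr rfl fun j _ => mul_comm _ _
  have hunit : IsUnit (MvPolynomial.C (c i) : MvPolynomial σ K) :=
    (isUnit_iff_ne_zero.mpr hi).map MvPolynomial.C
  exact hunit.dvd_mul_right.mp hdvd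

/-- **Saito's criterion**: homogeneous logarithmic derivations with nonzero coefficient
determinant, whose degrees sum to the number of hyperplanes, form a basis of the module of
logarithmic derivations. -/
theorem saito_criterion {ι : Type*} [Fintype ι] (c : ι → σ → K) (hc : ∀ h, c h ≠ 0)
    (hpair : ∀ h h', h ≠ h' → ∀ a : K, c h' ≠ a • c h)
    (M : Matrix σ σ (MvPolynomial σ K)) (d : σ → ℕ)
    (hM : ∀ a i, (M a i).IsHomogeneous (d a))
    (hlog : ∀ a h, linForm (c h) ∣ formAt (c h) (M a))
    (hdet : M.det ≠ 0) (hd : ∑ a, d a = Fintype.card ι)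
    (v : σ → MvPolynomial σ K) (hv : ∀ h, linForm (c h) ∣ formAt (c h) v) :
    v ∈ Submodule.span (MvPolynomial σ K) (Set.range M) := by
  have hrel : Pairwise (Function.onFun IsRelPrime fun h => linForm (c h)) :=
    fun h h' hne => isRelPrime_linForm (hc h) (hc h') (hpair h h' hne)
  have hprod (N : Matrix σ σ (MvPolynomial σ K))
      (hN : ∀ a h, linForm (c h) ∣ formAt (c h) (N a)) : ∏ h, linForm (c h) ∣ N.det :=
    Fintype.prod_dvd_of_isRelPrime hrel fun h => linForm_dvd_det (hc h) fun a => hN a h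
  have hhom : M.det.IsHomogeneous (Fintype.card ι) := by
    rw [Matrix.det_apply, ← hd]
    refine IsHomogeneous.sum _ _ _ fun τ _ => ?_
    rw [Units.smul_def, zsmul_eq_mul, ← Equiv.sum_comp τ d, ← map_intCast (MvPolynomial.C : K →+* MvPolynomial σ K)]
    exact (IsHomogeneous.prod _ _ _ fun i _ => hM (τ i) i).C_mul _
  have hassoc : M.det ∣ ∏ h, linForm (c h) := by
    obtain ⟨q, hq⟩ := hprod M hlog
    have hq0 : q ≠ 0 := by
      rintro rfl
      exact hdet (by simpa using hq)
    have hP0 : ∏ h, linForm (c h) ≠ 0 :=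
      Finset.prod_ne_zero_iff.mpr fun h _ => linForm_ne_zero (hc h)
    have hP : (∏ h, linForm (c h)).IsHomogeneous (∑ _h : ι, 1) :=
      IsHomogeneous.prod _ _ _ fun h _ => isHomogeneous_linForm (c h)
    have hdeg := congrArg MvPolynomial.totalDegree hq
    rw [totalDegree_mul_of_isDomain hP0 hq0, hP.totalDegree hP0, hhom.totalDegree hdet] at hdeg
    have hqC := totalDegree_eq_zero_iff_eq_C.mp
      (show q.totalDegree = 0 by simpa using hdeg)
    have hq0' : MvPolynomial.coeff 0 q ≠ 0 := fun h0 => hq0 (by rw [hqC, h0, map_zero])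
    have hunit : IsUnit q := by
      rw [hqC]
      exact (isUnit_iff_ne_zero.mpr hq0').map MvPolynomial.C
    rw [hq]
    exact hunit.mul_right_dvd.mpr dvd_rfl
  have hcramer (a : σ) : M.det ∣ M.transpose.cramer v a := by
    rw [Matrix.cramer_transpose_apply]
    refine hassoc.trans (hprod _ fun a' h => ?_)
    rcases eq_or_ne a' a with rfl | hne
    · rw [Matrix.updateRow_self]
      exact hv h
    · rw [Matrix.updateRow_ne hne]
      exact hlog a' h
  choose w hw using hcramer
  have hvw : v = ∑ a, w a • M a := by
    funext i
    have hi := congrFun (M.transpose.mulVec_cramer v) i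
    refine mul_left_cancel₀ hdet ?_
    rw [Matrix.det_transpose, Pi.smul_apply, smul_eq_mul] at hi
    rw [← hi, Finset.sum_apply, Finset.mul_sum]
    refine Finset.sum_congr rfl fun a _ => ?_
    rw [hw a, Pi.smul_apply, smul_eq_mul]
    change M a i * _ = _
    ring
  rw [hvw]
  exact Submodule.sum_mem _ fun a _ =>
    Submodule.smul_mem _ _ (Submodule.subset_span ⟨a, rfl⟩)

end Saito

/-! ### Discrete antiderivatives -/

section Antidifference

variable {σ K : Type*} [Field K]

/-- Substitution of `g` for the extra variable `none`. -/
def substNone (g : MvPolynomial σ K) : MvPolynomial (Option σ) K →ₐ[K] MvPolynomial σ K :=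
  MvPolynomial.aeval fun o => o.elim g MvPolynomial.X

@[simp]
lemma substNone_X_none (g : MvPolynomial σ K) :
    substNone g (MvPolynomial.X none) = g := by
  simp [substNone]

@[simp]
lemma substNone_X_some (g : MvPolynomial σ K) (i : σ) :
    substNone g (MvPolynomial.X (some i)) = MvPolynomial.X i := by
  simp [substNone]

@[simp]
lemma substNone_C (g : MvPolynomial σ K) (a : K) :
    substNone g (MvPolynomial.C a) = MvPolynomial.C a := by
  simp [substNone, MvPolynomial.algebraMap_eq]

lemma isHomogeneous_substNone {g : MvPolynomial σ K} (hg : g.IsHomogeneous 1)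
    {P : MvPolynomial (Option σ) K} {d : ℕ} (hP : P.IsHomogeneous d) :
    (substNone g P).IsHomogeneous d := by
  have h := hP.aeval (fun o : Option σ => o.elim g MvPolynomial.X) (n := 1) (by
    rintro (_ | i)
    · exact hg
    · exact isHomogeneous_X _ i)
  rwa [one_mul] at h

lemma sub_dvd_substNone_sub (g h : MvPolynomial σ K) (P : MvPolynomial (Option σ) K) :
    g - h ∣ substNone g P - substNone h P := by
  rw [← Ideal.mem_span_singleton, ← Ideal.Quotient.eq]
  have key : (Ideal.Quotient.mkₐ K (Ideal.span {g - h})).comp (substNone g) =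
      (Ideal.Quotient.mkₐ K (Ideal.span {g - h})).comp (substNone h) := by
    refine MvPolynomial.algHom_ext fun o => ?_
    rcases o with _ | i
    · simpa using Ideal.Quotient.eq.mpr (Ideal.mem_span_singleton_self (g - h))
    · simp
  exact DFunLike.congr_fun key P

variable [CharZero K]

lemma exists_antidifference_pow (z : σ) (n : ℕ) :
    ∃ S : MvPolynomial (Option σ) K, S.IsHomogeneous (n + 1) ∧
      ∀ g, substNone g S - substNone (g - MvPolynomial.X z) S = MvPolynomial.X z * g ^ n := by
  induction n using Nat.strong_induction_on with
  | _ n ih =>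
  choose S hS hdiff using fun k : Fin n => ih k k.2
  let w (k : Fin n) : MvPolynomial (Option σ) K :=
    MvPolynomial.C (((n + 1).choose k : K) * (-1) ^ (n - (k : ℕ))) *
      MvPolynomial.X (some z) ^ (n - (k : ℕ))
  refine ⟨MvPolynomial.C ((n + 1 : K)⁻¹) *
    (MvPolynomial.X none ^ (n + 1) - ∑ k, w k * S k), ?_, fun g => ?_⟩
  · refine (((isHomogeneous_X_pow _ _).sub (IsHomogeneous.sum _ _ _ fun k _ => ?_))).C_mul _
    have h := (isHomogeneous_C_mul_X_pow (((n + 1).choose k : K) * (-1) ^ (n - (k : ℕ)))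
      (some z) (n - (k : ℕ))).mul (hS k)
    rwa [show n - (k : ℕ) + (k + 1) = n + 1 by omega] at h
  · have hbinom : (g - MvPolynomial.X z) ^ (n + 1) = g ^ (n + 1) -
        ((n : MvPolynomial σ K) + 1) * MvPolynomial.X z * g ^ n -
        ∑ k : Fin n, MvPolynomial.C (((n + 1).choose k : K) * (-1) ^ (n - (k : ℕ))) *
          MvPolynomial.X z ^ (n - (k : ℕ)) * (MvPolynomial.X z * g ^ (k : ℕ)) := by
      rw [sub_eq_add_neg, add_pow, Finset.sum_range_succ, Finset.sum_range_succ,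
        ← Fin.sum_univ_eq_sum_range (fun k => g ^ k * (-MvPolynomial.X z) ^ (n + 1 - k) *
          ((n + 1).choose k : MvPolynomial σ K)) n]
      have hterm (k : Fin n) : g ^ (k : ℕ) * (-MvPolynomial.X z) ^ (n + 1 - k) *
          ((n + 1).choose k : MvPolynomial σ K) =
          -(MvPolynomial.C (((n + 1).choose k : K) * (-1) ^ (n - (k : ℕ))) *
          MvPolynomial.X z ^ (n - (k : ℕ)) * (MvPolynomial.X z * g ^ (k : ℕ))) := by
        rw [show n + 1 - (k : ℕ) = n - k + 1 by omega, neg_pow]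
        simp only [map_mul, map_pow, map_neg, map_one, map_natCast]
        ring
      simp only [hterm, Finset.sum_neg_distrib]
      simp
      ring
    have hn : (MvPolynomial.C ((n + 1 : K)⁻¹) : MvPolynomial σ K) * (n + 1) = 1 := by
      have : ((n : MvPolynomial σ K) + 1) = MvPolynomial.C (n + 1 : K) := by simp
      rw [this, ← MvPolynomial.C_mul, inv_mul_cancel₀ (by exact_mod_cast n.succ_ne_zero),
        MvPolynomial.C_1]
    have hsum : ∑ k, substNone g (w k * S k) -
        ∑ k, substNone (g - MvPolynomial.X z) (w k * S k) =
        ∑ k : Fin n, MvPolynomial.C (((n + 1).choose k : K) * (-1) ^ (n - (k : ℕ))) *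
          MvPolynomial.X z ^ (n - (k : ℕ)) * (MvPolynomial.X z * g ^ (k : ℕ)) := by
      rw [← Finset.sum_sub_distrib]
      refine Finset.sum_congr rfl fun k _ => ?_
      rw [← hdiff k g]
      simp only [w, map_mul (substNone _), map_pow (substNone _), substNone_C, substNone_X_some]
      ring
    simp only [map_mul (substNone _), map_sub (substNone _), map_pow (substNone _),
      map_sum (substNone _), substNone_C, substNone_X_none] at hsum ⊢
    linear_combination (-MvPolynomial.C ((n + 1 : K)⁻¹)) * hbinom
      - MvPolynomial.C ((n + 1 : K)⁻¹) * hsum + MvPolynomial.X z * g ^ n * hn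

lemma exists_antidifference [Fintype σ] (z : σ) {P : MvPolynomial (Option σ) K} {d : ℕ}
    (hP : P.IsHomogeneous d) :
    ∃ Q : MvPolynomial (Option σ) K, Q.IsHomogeneous (d + 1) ∧
      ∀ g, substNone g Q - substNone (g - MvPolynomial.X z) Q =
        MvPolynomial.X z * substNone g P := by
  choose S hS hdiff using exists_antidifference_pow (K := K) z
  refine ⟨∑ s ∈ P.support, MvPolynomial.C (MvPolynomial.coeff s P) *
    (∏ i : σ, MvPolynomial.X (some i) ^ s (some i)) * S (s none), ?_, fun g => ?_⟩
  · refine IsHomogeneous.sum _ _ _ fun s hs => ?_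
    have hdeg : ∑ i : σ, s (some i) + (s none + 1) = d + 1 := by
      have h : s.degree = d := by
        rw [Finsupp.degree_eq_weight_one]
        exact hP (MvPolynomial.mem_support_iff.mp hs)
      rw [Finsupp.degree_eq_sum, Fintype.sum_option] at h
      omega
    rw [← hdeg]
    exact ((IsHomogeneous.prod _ _ _ fun i _ => isHomogeneous_X_pow _ _).C_mul _).mul (hS _)
  · have hP' : substNone g P = ∑ s ∈ P.support, MvPolynomial.C (MvPolynomial.coeff s P) *
        (∏ i : σ, MvPolynomial.X i ^ s (some i)) * g ^ s none := by
      rw [substNone, MvPolynomial.aeval_def, MvPolynomial.eval₂_eq']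
      refine Finset.sum_congr rfl fun s _ => ?_
      rw [Fintype.prod_option, MvPolynomial.algebraMap_eq]
      simp only [Option.elim]
      ring
    rw [hP', map_sum, map_sum, ← Finset.sum_sub_distrib, Finset.mul_sum]
    refine Finset.sum_congr rfl fun s _ => ?_
    simp only [map_mul (substNone _), map_prod (substNone _), map_pow (substNone _),
      substNone_C, substNone_X_some]
    linear_combination MvPolynomial.C (MvPolynomial.coeff s P) *
      (∏ i : σ, MvPolynomial.X i ^ s (some i)) * hdiff (s none) g

end Antidifference

/-! ### The cone over the Catalan arrangement -/

/-- The hyperplanes of the cone over the Catalan arrangement: `none` is the hyperplane at infinity,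
and `some ⟨j, i, p⟩` is the hyperplane `x_i - x_j = p z`. -/
abbrev CatIndex (ℓ m : ℕ) :=
  Option (Σ j : Fin ℓ, Finset.Iio j × Finset.Icc (-(m : ℤ)) m)

/-- The coefficients of the linear form defining a hyperplane. -/
def catCoeff (ℓ m : ℕ) : CatIndex ℓ m → Fin (ℓ + 1) → ℂ
  | none => Pi.single (Fin.last ℓ) 1
  | some ⟨j, i, p⟩ => Pi.single i.1.castSucc 1 - Pi.single j.castSucc 1 -
      Pi.single (Fin.last ℓ) (p.1 : ℂ)

lemma formAt_catCoeff_none (ℓ m : ℕ) (f : Fin (ℓ + 1) → R ℓ) :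
    formAt (catCoeff ℓ m none) f = f (Fin.last ℓ) := by
  simp [formAt, catCoeff, Pi.single_apply, apply_ite MvPolynomial.C]

lemma formAt_catCoeff_some (ℓ m : ℕ) (j : Fin ℓ) (i : Finset.Iio j)
    (p : Finset.Icc (-(m : ℤ)) m) (f : Fin (ℓ + 1) → R ℓ) :
    formAt (catCoeff ℓ m (some ⟨j, i, p⟩)) f =
      f i.1.castSucc - f j.castSucc - (p.1 : R ℓ) * f (Fin.last ℓ) := by
  simp [formAt, catCoeff, Pi.single_apply, apply_ite MvPolynomial.C, sub_mul,
    Finset.sum_sub_distrib]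

lemma mem_DcCat_iff {ℓ m : ℕ} {f : Fin (ℓ + 1) → R ℓ} :
    f ∈ DcCat ℓ m ↔ ∀ h, linForm (catCoeff ℓ m h) ∣ formAt (catCoeff ℓ m h) f := by
  constructor
  · rintro ⟨hz, hf⟩ (_ | ⟨j, i, p⟩)
    · rw [linForm, formAt_catCoeff_none, formAt_catCoeff_none]
      exact hz
    · rw [linForm, formAt_catCoeff_some, formAt_catCoeff_some]
      have hp := Finset.mem_Icc.mp p.2
      exact hf i.1 j (Finset.mem_Iio.mp i.2) p.1 hp.1 hp.2
  · intro hf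
    refine ⟨?_, fun i j hij p hp hp' => ?_⟩
    · simpa only [linForm, formAt_catCoeff_none] using hf none
    · simpa only [linForm, formAt_catCoeff_some] using
        hf (some ⟨j, ⟨i, Finset.mem_Iio.mpr hij⟩, ⟨p, Finset.mem_Icc.mpr ⟨hp, hp'⟩⟩⟩)

lemma catCoeff_some_castSucc {ℓ m : ℕ} (j : Fin ℓ) (i : Finset.Iio j)
    (p : Finset.Icc (-(m : ℤ)) m) (k : Fin ℓ) :
    catCoeff ℓ m (some ⟨j, i, p⟩) k.castSucc =
      (if k = i.1 then 1 else 0) - (if k = j then 1 else 0) := by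
  simp [catCoeff, Pi.single_apply, Fin.castSucc_ne_last]

lemma catCoeff_some_last {ℓ m : ℕ} (j : Fin ℓ) (i : Finset.Iio j)
    (p : Finset.Icc (-(m : ℤ)) m) :
    catCoeff ℓ m (some ⟨j, i, p⟩) (Fin.last ℓ) = -(p.1 : ℂ) := by
  simp [catCoeff, (Fin.castSucc_ne_last _).symm]

lemma catCoeff_none_castSucc {ℓ m : ℕ} (k : Fin ℓ) : catCoeff ℓ m none k.castSucc = 0 := by
  simp [catCoeff, Fin.castSucc_ne_last]

lemma catCoeff_none_last {ℓ m : ℕ} : catCoeff ℓ m none (Fin.last ℓ) = 1 := by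
  simp [catCoeff]

lemma catCoeff_some_left {ℓ m : ℕ} (j : Fin ℓ) (i : Finset.Iio j)
    (p : Finset.Icc (-(m : ℤ)) m) : catCoeff ℓ m (some ⟨j, i, p⟩) i.1.castSucc = 1 := by
  simp [catCoeff_some_castSucc, (Finset.mem_Iio.mp i.2).ne]

lemma catCoeff_ne_zero {ℓ m : ℕ} (h : CatIndex ℓ m) : catCoeff ℓ m h ≠ 0 := by
  intro h0
  rcases h with _ | ⟨j, i, p⟩
  · simpa [catCoeff_none_last] using congrFun h0 (Fin.last ℓ)
  · simpa [catCoeff_some_left] using congrFun h0 i.1.castSucc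

lemma catCoeff_ne_smul {ℓ m : ℕ} (h h' : CatIndex ℓ m) (hne : h ≠ h') (a : ℂ) :
    catCoeff ℓ m h' ≠ a • catCoeff ℓ m h := by
  intro heq
  have e (k) := congrFun heq k
  simp only [Pi.smul_apply, smul_eq_mul] at e
  rcases h with _ | ⟨j, i, p⟩ <;> rcases h' with _ | ⟨j', i', p'⟩
  · exact hne rfl
  · simpa [catCoeff_some_left, catCoeff_none_castSucc] using e i'.1.castSucc
  · have ha : a = 0 := by
      simpa [catCoeff_some_left, catCoeff_none_castSucc] using (e i.1.castSucc).symm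
    simpa [catCoeff_none_last, ha] using e (Fin.last ℓ)
  · have hij := Finset.mem_Iio.mp i.2
    have hij' := Finset.mem_Iio.mp i'.2
    have hi := e i'.1.castSucc
    have hj := e j'.castSucc
    rw [catCoeff_some_castSucc, catCoeff_some_castSucc, if_pos rfl, if_neg hij'.ne] at hi
    rw [catCoeff_some_castSucc, catCoeff_some_castSucc, if_neg hij'.ne', if_pos rfl] at hj
    have hi' : i'.1 = i.1 ∨ i'.1 = j := by
      by_contra! hcon
      simp [hcon.1, hcon.2] at hi
    have hj' : j' = i.1 ∨ j' = j := by
      by_contra! hcon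
      simp [hcon.1, hcon.2] at hj
    have hii : i'.1 = i.1 := by
      rcases hi' with hi' | hi' <;> rcases hj' with hj' | hj' <;> first | exact hi' | omega
    have hjj : j' = j := by
      rcases hj' with hj' | hj' <;> first | exact hj' | omega
    have ha : a = 1 := by simpa [hii, hij.ne] using hi.symm
    have hp := e (Fin.last ℓ)
    rw [catCoeff_some_last, catCoeff_some_last, ha, one_mul, neg_inj, Int.cast_inj] at hp
    subst hjj
    exact hne (by rw [Subtype.ext hii, Subtype.ext hp])

lemma card_catIndex (n m : ℕ) : Fintype.card (CatIndex (n + 1) m) =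
    1 + ∑ r : Fin n, (m * (n + 1) + r + 1) := by
  have hIcc : ((m : ℤ) + 1 - -m).toNat = 2 * m + 1 := by omega
  have hgauss := Finset.sum_range_id_mul_two (n + 1)
  rw [Fintype.card_option, Fintype.card_sigma]
  simp only [Fintype.card_prod, Fintype.card_coe, Fin.card_Iio, Int.card_Icc, hIcc]
  rw [← Finset.sum_mul, Fin.sum_univ_eq_sum_range (fun i => i) (n + 1),
    Fin.sum_univ_eq_sum_range (fun r => m * (n + 1) + r + 1) n]
  rw [Finset.sum_add_distrib, Finset.sum_add_distrib]
  rw [Finset.sum_range_succ] at hgauss ⊢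
  simp only [Finset.sum_const, Finset.card_range, smul_eq_mul, Nat.add_sub_cancel] at hgauss ⊢
  nlinarith

/-- The discrete derivative `t ^ r * ∏ j, ∏ 1 ≤ k ≤ m, (t - x_j - k z)` of the polynomial defining
the `r`-th basis element; the variable `t` is indexed by `none`. -/
def catIntegrand (ℓ m r : ℕ) : MvPolynomial (Option (Fin (ℓ + 1))) ℂ :=
  MvPolynomial.X none ^ r * ∏ j : Fin ℓ, ∏ k : Fin m,
    (MvPolynomial.X none - MvPolynomial.X (some j.castSucc) -
      MvPolynomial.C ((k : ℂ) + 1) * MvPolynomial.X (some (Fin.last ℓ)))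

lemma isHomogeneous_catIntegrand (ℓ m r : ℕ) :
    (catIntegrand ℓ m r).IsHomogeneous (m * ℓ + r) := by
  have h : (catIntegrand ℓ m r).IsHomogeneous (r + ∑ _j : Fin ℓ, ∑ _k : Fin m, 1) :=
    (isHomogeneous_X_pow _ _).mul <| IsHomogeneous.prod _ _ _ fun j _ =>
      IsHomogeneous.prod _ _ _ fun k _ =>
        ((isHomogeneous_X _ _).sub (isHomogeneous_X _ _)).sub (isHomogeneous_C_mul_X _ _)
  convert h using 1
  simp
  ring

lemma substNone_catIntegrand (ℓ m r : ℕ) (g : R ℓ) :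
    substNone g (catIntegrand ℓ m r) = g ^ r * ∏ j : Fin ℓ, ∏ k : Fin m,
      (g - MvPolynomial.X j.castSucc -
        MvPolynomial.C ((k : ℂ) + 1) * MvPolynomial.X (Fin.last ℓ)) := by
  simp only [catIntegrand, map_mul (substNone g), map_pow (substNone g), map_prod (substNone g),
    map_sub (substNone g), substNone_X_none, substNone_X_some, substNone_C]

/-- `Q` is a discrete antiderivative of `catIntegrand ℓ m r` with step `z`. -/
def IsCatAntidifference (ℓ m r : ℕ) (Q : MvPolynomial (Option (Fin (ℓ + 1))) ℂ) : Prop :=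
  ∀ g, substNone g Q - substNone (g - MvPolynomial.X (Fin.last ℓ)) Q =
    MvPolynomial.X (Fin.last ℓ) * substNone g (catIntegrand ℓ m r)

/-- The vector field `∑ i, Q(x_i) ∂_i`. -/
def catField {ℓ : ℕ} (Q : MvPolynomial (Option (Fin (ℓ + 1))) ℂ) : Fin (ℓ + 1) → R ℓ :=
  Fin.snoc (α := fun _ => R ℓ) (fun i : Fin ℓ => substNone (MvPolynomial.X i.castSucc) Q) 0

namespace IsCatAntidifference

variable {ℓ m r : ℕ} {Q : MvPolynomial (Option (Fin (ℓ + 1))) ℂ}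

lemma substNone_add (hQ : IsCatAntidifference ℓ m r Q) (j : Fin ℓ) {k : ℕ} (hk : k ≤ m) :
    substNone (MvPolynomial.X j.castSucc + (k : R ℓ) * MvPolynomial.X (Fin.last ℓ)) Q =
      substNone (MvPolynomial.X j.castSucc) Q := by
  induction k with
  | zero => simp
  | succ k ih =>
    rw [← ih (by omega)]
    have h := hQ (MvPolynomial.X j.castSucc + ((k + 1 : ℕ) : R ℓ) * MvPolynomial.X (Fin.last ℓ))
    have h0 : substNone (MvPolynomial.X j.castSucc +
        ((k + 1 : ℕ) : R ℓ) * MvPolynomial.X (Fin.last ℓ)) (catIntegrand ℓ m r) = 0 := by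
      rw [substNone_catIntegrand]
      refine mul_eq_zero_of_right _ (Finset.prod_eq_zero (Finset.mem_univ j)
        (Finset.prod_eq_zero (Finset.mem_univ ⟨k, hk⟩) ?_))
      simp
    rw [h0, mul_zero, sub_eq_zero] at h
    rw [h]
    congr 2
    push_cast
    ring

lemma catField_mem (hQ : IsCatAntidifference ℓ m r Q) : catField Q ∈ DcCat ℓ m := by
  refine ⟨by simp [catField], fun i j _ p hp hp' => ?_⟩
  simp only [catField, Fin.snoc_castSucc, Fin.snoc_last, mul_zero, sub_zero]
  obtain ⟨k, rfl | rfl⟩ := p.eq_nat_or_neg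
  · rw [← hQ.substNone_add j (show k ≤ m by omega)]
    refine (dvd_of_eq ?_).trans (sub_dvd_substNone_sub _ _ Q)
    push_cast
    ring
  · rw [← hQ.substNone_add i (show k ≤ m by omega)]
    refine (dvd_of_eq ?_).trans (sub_dvd_substNone_sub _ _ Q)
    push_cast
    ring

end IsCatAntidifference

/-- The point `x_i = i (m + 1)`, `z = 1`. -/
def catPoint (ℓ m : ℕ) : Fin (ℓ + 1) → ℂ :=
  Fin.snoc (α := fun _ => ℂ) (fun i : Fin ℓ => (i : ℂ) * (m + 1)) 1

lemma eval_substNone_congr {ℓ : ℕ} (x : Fin (ℓ + 1) → ℂ) {g h : R ℓ}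
    (hgh : MvPolynomial.eval x g = MvPolynomial.eval x h)
    (P : MvPolynomial (Option (Fin (ℓ + 1))) ℂ) :
    MvPolynomial.eval x (substNone g P) = MvPolynomial.eval x (substNone h P) := by
  have hdvd := map_dvd (MvPolynomial.eval x) (sub_dvd_substNone_sub g h P)
  rwa [map_sub, map_sub, hgh, sub_self, zero_dvd_iff, sub_eq_zero] at hdvd

/-- The common factor of the values of the integrands at `x_i = i (m + 1)`, `z = 1`. -/
def catWeight (n m : ℕ) (i : Fin n) : ℂ :=
  ∏ j : Fin (n + 1), ∏ k : Fin m, (((i : ℂ) + 1) * (m + 1) - (j : ℂ) * (m + 1) - ((k : ℂ) + 1))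

lemma catWeight_ne_zero (n m : ℕ) (i : Fin n) : catWeight n m i ≠ 0 := by
  refine Finset.prod_ne_zero_iff.mpr fun j _ => Finset.prod_ne_zero_iff.mpr fun k _ h => ?_
  have h' : ((i : ℤ) + 1 - j) * (m + 1) = k + 1 := by
    have : ((((i : ℤ) + 1 - j) * (m + 1) : ℤ) : ℂ) = ((k + 1 : ℤ) : ℂ) := by
      push_cast
      linear_combination h
    exact_mod_cast this
  have hdvd : ((m : ℤ) + 1) ∣ k + 1 := ⟨_, by rw [← h', mul_comm]⟩
  have := Int.le_of_dvd (by omega) hdvd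
  omega

lemma IsCatAntidifference.eval_sub {n m r : ℕ} {Q : MvPolynomial (Option (Fin (n + 1 + 1))) ℂ}
    (hQ : IsCatAntidifference (n + 1) m r Q) (i : Fin n) :
    MvPolynomial.eval (catPoint (n + 1) m) (catField Q i.succ.castSucc) -
      MvPolynomial.eval (catPoint (n + 1) m) (catField Q i.castSucc.castSucc) =
    (((i : ℂ) + 1) * (m + 1)) ^ r * catWeight n m i := by
  have h := congrArg (MvPolynomial.eval (catPoint (n + 1) m))
    (hQ (MvPolynomial.X i.castSucc.castSucc +
      ((m : R (n + 1)) + 1) * MvPolynomial.X (Fin.last (n + 1))))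
  rw [show MvPolynomial.X i.castSucc.castSucc +
      ((m : R (n + 1)) + 1) * MvPolynomial.X (Fin.last (n + 1)) -
      MvPolynomial.X (Fin.last (n + 1)) = MvPolynomial.X i.castSucc.castSucc +
        (m : R (n + 1)) * MvPolynomial.X (Fin.last (n + 1)) by ring,
    hQ.substNone_add i.castSucc le_rfl, substNone_catIntegrand, map_sub] at h
  have hpt (j : Fin (n + 1)) : catPoint (n + 1) m j.castSucc = (j : ℂ) * (m + 1) := by
    simp [catPoint]
  have hlast : catPoint (n + 1) m (Fin.last (n + 1)) = 1 := by simp [catPoint]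
  simp only [catField, Fin.snoc_castSucc]
  rw [eval_substNone_congr (catPoint (n + 1) m) (g := MvPolynomial.X i.succ.castSucc)
      (h := MvPolynomial.X i.castSucc.castSucc + ((m : R (n + 1)) + 1) *
        MvPolynomial.X (Fin.last (n + 1))), h]
  · have hi : (i : ℂ) * (m + 1) + (m + 1) = ((i : ℂ) + 1) * (m + 1) := by ring
    simp [hpt, hlast, hi, catWeight]
  · simp only [map_add, map_mul, MvPolynomial.eval_X, hpt, hlast, map_natCast, map_one]
    simp
    ring

/-- The matrix with rows `∂_1 + ⋯ + ∂_ℓ`, the Euler field, and the fields `catField (Q r)`. -/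
def catMatrix {n : ℕ} (Q : Fin n → MvPolynomial (Option (Fin (n + 1 + 1))) ℂ) :
    Matrix (Fin (n + 1 + 1)) (Fin (n + 1 + 1)) (R (n + 1)) :=
  Fin.cons (Fin.snoc (α := fun _ => R (n + 1)) (fun _ : Fin (n + 1) => 1) 0)
    (Fin.cons MvPolynomial.X fun r => catField (Q r))

section

variable {n m : ℕ} {Q : Fin n → MvPolynomial (Option (Fin (n + 1 + 1))) ℂ}

lemma catMatrix_zero_castSucc (i : Fin (n + 1)) : catMatrix Q 0 i.castSucc = 1 := by
  simp [catMatrix]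

lemma catMatrix_zero_last : catMatrix Q 0 (Fin.last (n + 1)) = 0 := by
  simp [catMatrix]

lemma catMatrix_one : catMatrix Q (Fin.succ 0) = MvPolynomial.X := by
  simp only [catMatrix, Fin.cons_succ, Fin.cons_zero]

lemma catMatrix_succ_succ (r : Fin n) : catMatrix Q r.succ.succ = catField (Q r) := by
  simp only [catMatrix, Fin.cons_succ]

lemma catMatrix_mem (hQ : ∀ r : Fin n, IsCatAntidifference (n + 1) m r (Q r))
    (a : Fin (n + 1 + 1)) : catMatrix Q a ∈ DcCat (n + 1) m := by
  refine Fin.cases ?_ (fun a => Fin.cases ?_ (fun r => ?_) a) a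
  · refine ⟨by simp [catMatrix_zero_last], fun i j _ p _ _ => ?_⟩
    simp [catMatrix_zero_last, catMatrix_zero_castSucc]
  · rw [catMatrix_one]
    exact ⟨dvd_rfl, fun i j _ p _ _ => dvd_rfl⟩
  · rw [catMatrix_succ_succ]
    exact (hQ r).catField_mem

lemma isHomogeneous_catMatrix
    (hQ : ∀ r : Fin n, (Q r).IsHomogeneous (m * (n + 1) + r + 1)) (a i : Fin (n + 1 + 1)) :
    (catMatrix Q a i).IsHomogeneous
      (if (a : ℕ) = 0 then 0 else if (a : ℕ) = 1 then 1 else m * (n + 1) + (a : ℕ) - 1) := by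
  refine Fin.cases ?_ (fun a => Fin.cases ?_ (fun r => ?_) a) a
  · refine Fin.lastCases ?_ (fun i => ?_) i
    · rw [catMatrix_zero_last]
      exact isHomogeneous_zero _ _ _
    · rw [catMatrix_zero_castSucc]
      exact isHomogeneous_one _ _
  · rw [catMatrix_one]
    exact isHomogeneous_X _ i
  · rw [catMatrix_succ_succ]
    refine Fin.lastCases ?_ (fun i => ?_) i
    · simp only [catField, Fin.snoc_last]
      exact isHomogeneous_zero _ _ _
    · simp only [catField, Fin.snoc_castSucc]
      have hdeg : (if (r.succ.succ : ℕ) = 0 then 0 else if (r.succ.succ : ℕ) = 1 then 1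
          else m * (n + 1) + (r.succ.succ : ℕ) - 1) = m * (n + 1) + r + 1 := by
        simp [← add_assoc]
      rw [hdeg]
      exact isHomogeneous_substNone (isHomogeneous_X _ _) (hQ r)

lemma det_catMatrix_ne_zero (hQ : ∀ r : Fin n, IsCatAntidifference (n + 1) m r (Q r)) :
    (catMatrix Q).det ≠ 0 := by
  intro hdet
  have hpt : (((MvPolynomial.eval (catPoint (n + 1) m)).mapMatrix (catMatrix Q))).det = 0 := by
    rw [← RingHom.map_det, hdet, map_zero]
  obtain ⟨v, hv0, hv⟩ := Matrix.exists_vecMul_eq_zero_iff.mpr hpt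
  have hcol (i : Fin (n + 1 + 1)) :
      ∑ a, v a * MvPolynomial.eval (catPoint (n + 1) m) (catMatrix Q a i) = 0 := congrFun hv i
  simp only [Fin.sum_univ_succ (n := n + 1), Fin.sum_univ_succ (n := n), catMatrix_one,
    catMatrix_succ_succ] at hcol
  have hv1 : v (Fin.succ 0) = 0 := by
    simpa [catMatrix_zero_last, catField, catPoint] using hcol (Fin.last (n + 1))
  have hentry (i : Fin (n + 1)) : v 0 + ∑ r : Fin n, v r.succ.succ *
      MvPolynomial.eval (catPoint (n + 1) m) (catField (Q r) i.castSucc) = 0 := by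
    simpa only [catMatrix_zero_castSucc, map_one, mul_one, hv1, zero_mul, zero_add] using
      hcol i.castSucc
  have hvand : (fun r : Fin n => v r.succ.succ) = 0 := by
    refine Matrix.eq_zero_of_forall_index_sum_pow_mul_eq_zero
      (f := fun i : Fin n => ((i : ℂ) + 1) * (m + 1)) (fun i j hij => ?_) fun i => ?_
    · have hm : (m : ℂ) + 1 ≠ 0 := by exact_mod_cast m.succ_ne_zero
      have := mul_right_cancel₀ hm hij
      exact Fin.ext (by exact_mod_cast add_right_cancel this)
    · refine mul_right_cancel₀ (catWeight_ne_zero n m i) ?_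
      have hsub := congrArg₂ (· - ·) (hentry i.succ) (hentry i.castSucc)
      beta_reduce at hsub
      rw [add_sub_add_left_eq_sub, sub_zero, ← Finset.sum_sub_distrib] at hsub
      simp only [← mul_sub, fun r => (hQ r).eval_sub i] at hsub
      rw [zero_mul, ← hsub, Finset.sum_mul]
      exact Finset.sum_congr rfl fun r _ => by ring
  have hv0' : v 0 = 0 := by
    have h := hentry 0
    simpa [fun r => congrFun hvand r] using h
  refine hv0 (funext fun a => Fin.cases hv0' (fun a => Fin.cases hv1 (fun r => ?_) a) a)
  exact congrFun hvand r

end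

theorem stmt12 (ℓ m : ℕ) (hℓ : 2 ≤ ℓ) (hm : 1 ≤ m) :
    ∃ b : Fin (ℓ + 1) → (Fin (ℓ + 1) → R ℓ),
      (∀ a : Fin (ℓ + 1),
        b a ∈ DcCat ℓ m ∧
        ∀ i : Fin (ℓ + 1),
          (b a i).IsHomogeneous
            (if (a : ℕ) = 0 then 0 else if (a : ℕ) = 1 then 1
              else m * ℓ + (a : ℕ) - 1)) ∧
      LinearIndependent (R ℓ) b ∧
      (∀ v ∈ DcCat ℓ m, v ∈ Submodule.span (R ℓ) (Set.range b)) := by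
  obtain ⟨n, rfl⟩ : ∃ n, ℓ = n + 1 := ⟨ℓ - 1, by omega⟩
  choose Q hQhom hQ using fun r : Fin n =>
    exists_antidifference (Fin.last (n + 1)) (isHomogeneous_catIntegrand (n + 1) m r)
  have hmem := catMatrix_mem (m := m) hQ
  have hhom := isHomogeneous_catMatrix hQhom
  have hdet := det_catMatrix_ne_zero (m := m) hQ
  refine ⟨catMatrix Q, fun a => ⟨hmem a, hhom a⟩,
    Matrix.linearIndependent_rows_of_det_ne_zero hdet, fun v hv => ?_⟩
  refine saito_criterion (catCoeff (n + 1) m) catCoeff_ne_zero catCoeff_ne_smul _ _ hhom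
    (fun a => mem_DcCat_iff.mp (hmem a)) hdet ?_ v (mem_DcCat_iff.mp hv)
  rw [card_catIndex, Fin.sum_univ_succ, Fin.sum_univ_succ]
  simp [← add_assoc]

end
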